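/- For any σ ∈ S_n, τ ∈ S_m and 1 ≤ i ≤ n, the descent set of the permutation B_i(σ,τ) equals the insertion of descent sets: Des(B_i(σ,τ)) = B_i(Des(σ), Des(τ)), where on the right B_i denotes the insertion operation on subsets. -/

import Mathlib

open Equiv

/-- The one-line value (0-indexed) of a permutation of `Fin N`, extended to all of `ℕ`
by the identity.  Position `j` (0-indexed) carries the value `pv σ j` (0-indexed). -/
def pv {N : ℕ} (σ : Equiv.Perm (Fin N)) (j : ℕ) : ℕ :=
  if h : j < N then (σ ⟨j, h⟩ : ℕ) else j

/-- The left weak (Bruhat) order on `S_N`: inclusion of inversion sets, where the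
inversion set of `σ` is `{(p,q) | p < q ∧ σ p > σ q}`. -/
def wle {N : ℕ} (σ τ : Equiv.Perm (Fin N)) : Prop :=
  ∀ p q : Fin N, p < q → σ q < σ p → τ q < τ p

instance {N : ℕ} (σ τ : Equiv.Perm (Fin N)) : Decidable (wle σ τ) :=
  inferInstanceAs (Decidable (∀ p q : Fin N, p < q → σ q < σ p → τ q < τ p))

/-- The `a`-values of the insertion construction `B_i` (0-indexed values):
`avv m s x = x` if `x < s` and `x + m - 1` otherwise. -/
def avv (m s x : ℕ) : ℕ := if x < s then x else x + m - 1

/-- The one-line values of the permutation `B_i(σ,τ) ∈ S_{n+m-1}`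
(0-indexed position `i`, with `i < n`, and 0-indexed values). -/
def BFun {n m : ℕ} (i : ℕ) (σ : Equiv.Perm (Fin n)) (τ : Equiv.Perm (Fin m)) (j : ℕ) : ℕ :=
  if j < i then avv m (pv σ i) (pv σ j)
  else if j < i + m then pv τ (j - i) + pv σ i
  else avv m (pv σ i) (pv σ (j - m + 1))

/-- `ρ ∈ S_{n+m-1}` is the permutation `B_i(σ,τ)`. -/
def IsB {n m : ℕ} (i : ℕ) (σ : Equiv.Perm (Fin n)) (τ : Equiv.Perm (Fin m))
    (ρ : Equiv.Perm (Fin (n + m - 1))) : Prop :=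
  ∀ j : ℕ, j < n + m - 1 → pv ρ j = BFun i σ τ j

/-- The descent set of a permutation, 0-indexed: `p ∈ Des σ` iff `σ_p > σ_{p+1}`
(so `Des σ ⊆ {0,…,N-2}`, corresponding to the 1-indexed set `[N-1]`). -/
def DesSet {N : ℕ} (σ : Equiv.Perm (Fin N)) : Set ℕ :=
  {p | p + 1 < N ∧ pv σ (p + 1) < pv σ p}

/-- The set of global descents of a permutation, 0-indexed: `p ∈ GDes σ` iff
`σ_a > σ_b` for all `a ≤ p < b`. -/
def GDes {N : ℕ} (σ : Equiv.Perm (Fin N)) : Set ℕ :=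
  {p | p + 1 < N ∧ ∀ a b : ℕ, a ≤ p → p < b → b < N → pv σ b < pv σ a}

/-- A permutation is closed when its descent set coincides with its set of global descents. -/
def ClosedPerm {N : ℕ} (σ : Equiv.Perm (Fin N)) : Prop := DesSet σ = GDes σ

/-- The insertion operation on subsets (0-indexed): for `S ⊆ {0,…,n-2}`, `T ⊆ {0,…,m-2}`
and insertion position `i` (with `i < n`),
`B_i(S,T) = (S ∩ [0,i-1]) ∪ (T + i) ∪ ((S ∩ [i,n-2]) + (m-1)) ⊆ {0,…,n+m-3}`. -/
def BSet (m i : ℕ) (S T : Set ℕ) : Set ℕ :=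
  (S ∩ {p | p < i}) ∪ ((· + i) '' T) ∪ ((· + (m - 1)) '' (S ∩ {p | i ≤ p}))

theorem pv_lt {N : ℕ} (σ : Equiv.Perm (Fin N)) {j : ℕ} (h : j < N) : pv σ j < N := by
  simp [pv, h]

theorem pv_ne {N : ℕ} (σ : Equiv.Perm (Fin N)) {j k : ℕ} (hj : j < N) (hk : k < N)
    (hjk : j ≠ k) : pv σ j ≠ pv σ k := by
  simpa [pv, hj, hk, Fin.val_inj] using hjk

theorem avv_lt_avv_iff {m s x y : ℕ} (hm : 1 ≤ m) :
    avv m s x < avv m s y ↔ x < y := by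
  unfold avv
  split_ifs <;> omega

theorem avv_lt_add_iff {m s x t : ℕ} (ht : t < m) :
    avv m s x < t + s ↔ x < s := by
  unfold avv
  split_ifs <;> omega

theorem add_lt_avv_iff {m s x t : ℕ} (hx : x ≠ s) (ht : t < m) :
    t + s < avv m s x ↔ s < x := by
  unfold avv
  split_ifs <;> omega

theorem mem_BSet {m i : ℕ} {S T : Set ℕ} {p : ℕ} :
    p ∈ BSet m i S T ↔
      (p ∈ S ∧ p < i) ∨ (i ≤ p ∧ p - i ∈ T) ∨ (i + (m - 1) ≤ p ∧ p - (m - 1) ∈ S) := by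
  simp only [BSet, Set.mem_union, Set.mem_inter_iff, Set.mem_ofPred_eq, Set.mem_image, or_assoc]
  refine or_congr Iff.rfl (or_congr ⟨?_, ?_⟩ ⟨?_, ?_⟩)
  · rintro ⟨q, hq, rfl⟩
    exact ⟨by omega, by simpa using hq⟩
  · rintro ⟨hp, hq⟩
    exact ⟨p - i, hq, by omega⟩
  · rintro ⟨q, ⟨hq, hiq⟩, rfl⟩
    exact ⟨by omega, by simpa using hq⟩
  · rintro ⟨hp, hq⟩
    exact ⟨p - (m - 1), ⟨hq, by omega⟩, by omega⟩

/-- **Lemma.** `Des (B_i(σ,τ)) = B_i(Des σ, Des τ)`. -/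
theorem Des_B {n m : ℕ} (hn : 1 ≤ n) (hm : 1 ≤ m) (i : ℕ) (hi : i < n)
    (σ : Equiv.Perm (Fin n)) (τ : Equiv.Perm (Fin m))
    (ρ : Equiv.Perm (Fin (n + m - 1))) (hρ : IsB i σ τ ρ) :
    DesSet ρ = BSet m i (DesSet σ) (DesSet τ) := by
  ext p
  rw [mem_BSet]
  simp only [DesSet, Set.mem_ofPred_eq]
  by_cases hp : p + 1 < n + m - 1
  swap
  · constructor
    · exact fun h => absurd h.1 hp
    · rintro (h | h | h) <;> omega
  rw [hρ p (by omega), hρ (p + 1) hp]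
  rcases lt_or_ge p i with hpi | hpi
  · have hlt : BFun i σ τ (p + 1) < BFun i σ τ p ↔ pv σ (p + 1) < pv σ p := by
      unfold BFun
      rcases Nat.lt_or_ge (p + 1) i with h | h
      · rw [if_pos h, if_pos hpi, avv_lt_avv_iff hm]
      · obtain rfl : i = p + 1 := by omega
        rw [if_neg (lt_irrefl _), if_pos (by omega), if_pos hpi, Nat.sub_self,
          add_lt_avv_iff (pv_ne σ (by omega) hi (by omega)) (pv_lt τ hm)]
    rw [hlt]
    omega
  · unfold BFun
    rw [if_neg (show ¬ p + 1 < i by omega), if_neg (show ¬ p < i by omega)]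
    rcases Nat.lt_or_ge (p + 1) (i + m) with h | h
    · rw [if_pos h, if_pos (by omega), show p + 1 - i = p - i + 1 by omega]
      omega
    · have hσ : p + 1 - m + 1 = p - (m - 1) + 1 := by omega
      rw [if_neg (by omega), hσ]
      rcases Nat.lt_or_ge p (i + m) with h' | h'
      · obtain rfl : i = p - (m - 1) := by omega
        rw [if_pos h', avv_lt_add_iff (pv_lt τ (by omega))]
        omega
      · rw [if_neg (by omega), avv_lt_avv_iff hm, show p - m + 1 = p - (m - 1) by omega]
        omega
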